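/- arXiv:1408.3147 — 5 statements merged into one kernel-verified Lean document; each statement's English description precedes it below -/
import Mathlib

section
/- The class of finite bounded lattices has the amalgamation property: if A, B₀ and B₁ are finite bounded lattices and f₀ : A → B₀ and f₁ : A → B₁ are lattice embeddings preserving 0 and 1, then there are a finite bounded lattice C and lattice embeddings g₀ : B₀ → C and g₁ : B₁ → C preserving 0 and 1 such that g₀ ∘ f₀ = g₁ ∘ f₁. -/
/-- A lattice embedding between bounded lattices which also preserves `⊥`
and `⊤`: an injective map preserving `⊔`, `⊓`, `⊥` and `⊤`. -/
def IsBddLatEmb {X Y : Type*} [Lattice X] [BoundedOrder X]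
    [Lattice Y] [BoundedOrder Y] (f : X → Y) : Prop :=
  Function.Injective f ∧
  (∀ a b : X, f (a ⊔ b) = f a ⊔ f b) ∧
  (∀ a b : X, f (a ⊓ b) = f a ⊓ f b) ∧
  f ⊥ = ⊥ ∧ f ⊤ = ⊤

/-- A bundled bounded lattice (a type with a lattice structure and a least
and a greatest element). -/
structure BddLatticeStr where
  carrier : Type
  [latt : Lattice carrier]
  [bdd : BoundedOrder carrier]

attribute [instance] BddLatticeStr.latt BddLatticeStr.bdd

instance : CoeSort BddLatticeStr Type := ⟨BddLatticeStr.carrier⟩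

lemma exists_bdd_of_semilatticeInf (S : Type*) [SemilatticeInf S] [OrderTop S] [Finite S] :
    ∃ C : BddLatticeStr, Finite C.carrier ∧ Nonempty (S ≃o C.carrier) := by
  classical
  have := Fintype.ofFinite S
  let e : Fin (Fintype.card S) ≃ S := (Fintype.equivFin S).symm
  let P : PartialOrder (Fin (Fintype.card S)) := PartialOrder.lift e e.injective
  have hle : ∀ x y, P.le x y ↔ e x ≤ e y := fun x y => Iff.rfl
  let L : Lattice (Fin (Fintype.card S)) :=
    { P with
      inf := fun x y => e.symm (e x ⊓ e y)
      sup := fun x y => e.symm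
        ((Finset.univ.filter (fun z : S => e x ≤ z ∧ e y ≤ z)).inf id)
      inf_le_left := fun x y => (hle _ _).2 (by simp)
      inf_le_right := fun x y => (hle _ _).2 (by simp)
      le_inf := fun x y z h1 h2 => (hle _ _).2 (by
        simpa using ⟨(hle _ _).1 h1, (hle _ _).1 h2⟩)
      le_sup_left := fun x y => (hle _ _).2 (by
        rw [Equiv.apply_symm_apply]
        exact Finset.le_inf fun z hz => (Finset.mem_filter.1 hz).2.1)
      le_sup_right := fun x y => (hle _ _).2 (by
        rw [Equiv.apply_symm_apply]
        exact Finset.le_inf fun z hz => (Finset.mem_filter.1 hz).2.2)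
      sup_le := fun x y z h1 h2 => (hle _ _).2 (by
        rw [Equiv.apply_symm_apply]
        exact Finset.inf_le (f := id) (Finset.mem_filter.2
          ⟨Finset.mem_univ _, (hle _ _).1 h1, (hle _ _).1 h2⟩)) }
  let Bd : @BoundedOrder (Fin (Fintype.card S)) P.toLE :=
    @BoundedOrder.mk _ P.toLE
      (@OrderTop.mk _ P.toLE ⟨e.symm ⊤⟩ (fun x => (hle _ _).2 (by
        show e x ≤ e (e.symm ⊤)
        simp)))
      (@OrderBot.mk _ P.toLE ⟨e.symm (Finset.univ.inf id)⟩ (fun x => (hle _ _).2 (by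
        show e (e.symm (Finset.univ.inf id)) ≤ e x
        rw [Equiv.apply_symm_apply]
        exact Finset.inf_le (f := id) (Finset.mem_univ _))))
  refine ⟨@BddLatticeStr.mk (Fin (Fintype.card S)) L Bd, ?_, ⟨?_⟩⟩
  · exact inferInstanceAs (Finite (Fin (Fintype.card S)))
  · refine ⟨e.symm, ?_⟩
    intro a b
    show e (e.symm a) ≤ e (e.symm b) ↔ a ≤ b
    simp

lemma exists_radj {A B : Type*} [Lattice A] [BoundedOrder A] [Finite A]
    [Lattice B] [BoundedOrder B] (f : A → B) (hf : IsBddLatEmb f) :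
    ∃ r : B → A, ∀ a b, f a ≤ b ↔ a ≤ r b := by
  classical
  have := Fintype.ofFinite A
  obtain ⟨-, hs, -, hb, -⟩ := hf
  have hm : Monotone f := fun a b h => by
    have := hs a b
    rw [sup_eq_right.2 h] at this
    rw [this]; exact le_sup_left
  refine ⟨fun b => (Finset.univ.filter (fun a => f a ≤ b)).sup id, fun a b => ⟨fun h =>
    Finset.le_sup (f := id) (by simpa using h), fun h => (hm h).trans ?_⟩⟩
  refine Finset.sup_induction (p := fun a => f a ≤ b) (by simp [hb]) ?_ ?_
  · intro x hx y hy
    rw [hs]; exact sup_le hx hy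
  · intro x hx
    simpa using hx

lemma emb_le_iff {A B : Type*} [Lattice A] [BoundedOrder A]
    [Lattice B] [BoundedOrder B] (f : A → B) (hf : IsBddLatEmb f) (a b : A) :
    f a ≤ f b ↔ a ≤ b := by
  rw [← sup_eq_right, ← hf.2.1, hf.1.eq_iff, sup_eq_right]

/-- The amalgam. -/
abbrev Amal {A B₀ B₁ : Type*} [Lattice B₀] [Lattice B₁] (f₀ : A → B₀) (f₁ : A → B₁) :=
  {p : B₀ × B₁ // ∀ a, f₀ a ≤ p.1 ↔ f₁ a ≤ p.2}

lemma emb_of_order {S B : Type*} [PartialOrder S] [Lattice B] [BoundedOrder B]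
    (C : BddLatticeStr) (e : S ≃o C.carrier) (g : B → S)
    (hg : ∀ x y, g x ≤ g y ↔ x ≤ y)
    (hsup : ∀ x y z, g x ≤ z → g y ≤ z → g (x ⊔ y) ≤ z)
    (hinf : ∀ x y z, z ≤ g x → z ≤ g y → z ≤ g (x ⊓ y))
    (hbot : ∀ z, g ⊥ ≤ z) (htop : ∀ z, z ≤ g ⊤) : IsBddLatEmb (fun b => e (g b)) := by
  refine ⟨?_, ?_, ?_, ?_, ?_⟩
  · intro x y h
    have h := e.injective h
    exact le_antisymm ((hg _ _).1 h.le) ((hg _ _).1 h.ge)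
  · intro x y
    apply le_antisymm
    · rw [← e.le_symm_apply]
      exact hsup _ _ _ (e.le_symm_apply.2 le_sup_left) (e.le_symm_apply.2 le_sup_right)
    · exact sup_le (e.monotone ((hg _ _).2 le_sup_left)) (e.monotone ((hg _ _).2 le_sup_right))
  · intro x y
    apply le_antisymm
    · exact le_inf (e.monotone ((hg _ _).2 inf_le_left)) (e.monotone ((hg _ _).2 inf_le_right))
    · rw [← e.symm_apply_le]
      exact hinf _ _ _ (e.symm_apply_le.2 inf_le_left) (e.symm_apply_le.2 inf_le_right)
  · exact le_bot_iff.1 (e.le_symm_apply.1 (hbot _))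
  · exact top_le_iff.1 (e.symm_apply_le.1 (htop _))

/-- The amalgamation property for finite bounded lattices (Lemma 1.5 of
Shore–Kjos-Hanssen): if `A`, `B₀`, `B₁` are finite bounded lattices and
`f₀ : A → B₀`, `f₁ : A → B₁` are lattice embeddings preserving `⊥` and `⊤`,
then there are a finite bounded lattice `C` and lattice embeddings
`g₀ : B₀ → C`, `g₁ : B₁ → C` preserving `⊥` and `⊤` with
`g₀ ∘ f₀ = g₁ ∘ f₁`. -/
theorem stmt1 {A B₀ B₁ : Type*}
    [Lattice A] [BoundedOrder A] [Finite A]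
    [Lattice B₀] [BoundedOrder B₀] [Finite B₀]
    [Lattice B₁] [BoundedOrder B₁] [Finite B₁]
    (f₀ : A → B₀) (f₁ : A → B₁)
    (hf₀ : IsBddLatEmb f₀) (hf₁ : IsBddLatEmb f₁) :
    ∃ C : BddLatticeStr, Finite C.carrier ∧
      ∃ (g₀ : B₀ → C.carrier) (g₁ : B₁ → C.carrier),
        IsBddLatEmb g₀ ∧ IsBddLatEmb g₁ ∧ g₀ ∘ f₀ = g₁ ∘ f₁ := by
  obtain ⟨r₀, hr₀⟩ := exists_radj f₀ hf₀
  obtain ⟨r₁, hr₁⟩ := exists_radj f₁ hf₁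
  have m₀ := emb_le_iff f₀ hf₀
  have m₁ := emb_le_iff f₁ hf₁
  have t₀ : ∀ b, f₀ (r₀ b) ≤ b := fun b => (hr₀ _ _).2 le_rfl
  have t₁ : ∀ b, f₁ (r₁ b) ≤ b := fun b => (hr₁ _ _).2 le_rfl
  have u₀ : ∀ a, r₀ (f₀ a) = a := fun a =>
    le_antisymm ((m₀ _ _).1 (t₀ _)) ((hr₀ _ _).1 le_rfl)
  have u₁ : ∀ a, r₁ (f₁ a) = a := fun a =>
    le_antisymm ((m₁ _ _).1 (t₁ _)) ((hr₁ _ _).1 le_rfl)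
  have n₀ : ∀ x y, x ≤ y → r₀ x ≤ r₀ y := fun x y h => (hr₀ _ _).1 ((t₀ x).trans h)
  have n₁ : ∀ x y, x ≤ y → r₁ x ≤ r₁ y := fun x y h => (hr₁ _ _).1 ((t₁ x).trans h)
  have i₀ : ∀ x y, r₀ x ⊓ r₀ y ≤ r₀ (x ⊓ y) := fun x y => (hr₀ _ _).1
    (le_inf ((hr₀ _ _).2 inf_le_left) ((hr₀ _ _).2 inf_le_right))
  have i₁ : ∀ x y, r₁ x ⊓ r₁ y ≤ r₁ (x ⊓ y) := fun x y => (hr₁ _ _).1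
    (le_inf ((hr₁ _ _).2 inf_le_left) ((hr₁ _ _).2 inf_le_right))
  have hT : r₀ ⊤ = ⊤ := by rw [← hf₀.2.2.2.2, u₀]
  have hT' : r₁ ⊤ = ⊤ := by rw [← hf₁.2.2.2.2, u₁]
  letI : SemilatticeInf (Amal f₀ f₁) := Subtype.semilatticeInf (by
    intro p q hp hq a
    simp [hp a, hq a])
  letI : OrderTop (Amal f₀ f₁) := 
    { top := ⟨⊤, by simp⟩
      le_top := fun x => show x.1 ≤ ⊤ from le_top }
  obtain ⟨C, hC, ⟨e⟩⟩ := exists_bdd_of_semilatticeInf (Amal f₀ f₁)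
  let g₀ : B₀ → Amal f₀ f₁ := fun b => ⟨(b, f₁ (r₀ b)), fun a => by simp [hr₀, m₁]⟩
  let g₁ : B₁ → Amal f₀ f₁ := fun b => ⟨(f₀ (r₁ b), b), fun a => by simp [hr₁, m₀]⟩
  have d : ∀ x y : Amal f₀ f₁, x ≤ y ↔ x.1.1 ≤ y.1.1 ∧ x.1.2 ≤ y.1.2 := fun x y => Iff.rfl
  have l₀ : ∀ b z, g₀ b ≤ z ↔ b ≤ z.1.1 := fun b z => ⟨fun h => ((d _ _).1 h).1, fun h =>
    (d _ _).2 ⟨h, (z.2 _).1 ((t₀ b).trans h)⟩⟩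
  have l₁ : ∀ b z, g₁ b ≤ z ↔ b ≤ z.1.2 := fun b z => ⟨fun h => ((d _ _).1 h).2, fun h =>
    (d _ _).2 ⟨(z.2 _).2 ((t₁ b).trans h), h⟩⟩
  refine ⟨C, hC, fun b => e (g₀ b), fun b => e (g₁ b), ?_, ?_, ?_⟩
  · apply emb_of_order
    · intro x y; exact l₀ _ _
    · intro x y z hx hy
      rw [l₀] at *
      exact sup_le hx hy
    · intro x y z hx hy
      rw [d] at *
      refine ⟨le_inf hx.1 hy.1, (le_inf hx.2 hy.2).trans ?_⟩
      show f₁ (r₀ x) ⊓ f₁ (r₀ y) ≤ f₁ (r₀ (x ⊓ y))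
      rw [← hf₁.2.2.1, m₁]
      exact i₀ x y
    · intro z; rw [l₀]; exact bot_le
    · intro z; rw [d]
      refine ⟨le_top, ?_⟩
      show _ ≤ f₁ (r₀ ⊤)
      rw [hT, hf₁.2.2.2.2]; exact le_top
  · apply emb_of_order
    · intro x y; exact l₁ _ _
    · intro x y z hx hy
      rw [l₁] at *
      exact sup_le hx hy
    · intro x y z hx hy
      rw [d] at *
      refine ⟨(le_inf hx.1 hy.1).trans ?_, le_inf hx.2 hy.2⟩
      show f₀ (r₁ x) ⊓ f₀ (r₁ y) ≤ f₀ (r₁ (x ⊓ y))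
      rw [← hf₀.2.2.1, m₀]
      exact i₁ x y
    · intro z; rw [l₁]; exact bot_le
    · intro z; rw [d]
      refine ⟨?_, le_top⟩
      show _ ≤ f₀ (r₁ ⊤)
      rw [hT', hf₀.2.2.2.2]; exact le_top
  · funext a
    show e (g₀ (f₀ a)) = e (g₁ (f₁ a))
    congr 1
    apply Subtype.ext
    show (f₀ a, f₁ (r₀ (f₀ a))) = (f₀ (r₁ (f₁ a)), f₁ a)
    rw [u₀, u₁]
end

section
/- Let L be a finite bounded lattice, L̂ a sublowersemilattice of L, and Θ a finite usl representation of L̂ (a finite set of functions from L̂ to ℕ). Then every α ∈ Θ can be extended to a function with domain L, and finitely many further functions with domain L can be added, so that the resulting finite set Θ' of functions from L to ℕ is an usl representation of L with Θ ⊆ Θ'↾L̂ = {α↾L̂ : α ∈ Θ'}. -/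
/-- An usl representation of a bounded lattice `L` (viewed as an upper
semilattice with least element `⊥`): a set `Θ` of functions `L → ℕ`
containing the constantly-`0` function such that every `α ∈ Θ` satisfies
`α ⊥ = 0`, together with the differentiation, order and join properties. -/
def IsUslRep {L : Type*} [Lattice L] [BoundedOrder L] (Θ : Set (L → ℕ)) : Prop :=
  (fun _ => 0) ∈ Θ ∧
  (∀ α ∈ Θ, α ⊥ = 0) ∧
  (∀ x y : L, ¬x ≤ y → ∃ γ ∈ Θ, ∃ δ ∈ Θ, γ y = δ y ∧ γ x ≠ δ x) ∧
  (∀ α ∈ Θ, ∀ β ∈ Θ, ∀ x y : L, x ≤ y → α y = β y → α x = β x) ∧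
  (∀ α ∈ Θ, ∀ β ∈ Θ, ∀ x y z : L, x ⊔ y = z → α x = β x → α y = β y → α z = β z)

/-- A sublowersemilattice (slsl) of a bounded lattice: a subset containing
`⊥` and `⊤` and closed under the meet of `L`. -/
def IsSlsl {L : Type*} [Lattice L] [BoundedOrder L] (S : Set L) : Prop :=
  ⊥ ∈ S ∧ ⊤ ∈ S ∧ ∀ x ∈ S, ∀ y ∈ S, x ⊓ y ∈ S

/-- `Θ` (given by the restrictions to `S` of its members) is an usl
representation of the subset `S` of `L`, where `S` carries the induced order
and its own join: `z` is the join of `x` and `y` in `S` iff it is the least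
element of `S` above both. -/
def IsUslRepOn {L : Type*} [Lattice L] [BoundedOrder L] (S : Set L) (Θ : Set (L → ℕ)) : Prop :=
  (∃ α ∈ Θ, ∀ x ∈ S, α x = 0) ∧
  (∀ α ∈ Θ, α ⊥ = 0) ∧
  (∀ x ∈ S, ∀ y ∈ S, ¬x ≤ y → ∃ γ ∈ Θ, ∃ δ ∈ Θ, γ y = δ y ∧ γ x ≠ δ x) ∧
  (∀ α ∈ Θ, ∀ β ∈ Θ, ∀ x ∈ S, ∀ y ∈ S, x ≤ y → α y = β y → α x = β x) ∧
  (∀ α ∈ Θ, ∀ β ∈ Θ, ∀ x ∈ S, ∀ y ∈ S, ∀ z ∈ S,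
    IsLeast {w ∈ S | x ≤ w ∧ y ≤ w} z → α x = β x → α y = β y → α z = β z)

/-- Extension of representations (Proposition 5.3 of Shore–Kjos-Hanssen):
if `Θ` is a finite usl representation of a sublowersemilattice `S` of a
finite bounded lattice `L` (members of `Θ` being regarded as functions on `S`,
i.e. only their values on `S` matter), then there is a finite usl
representation `Θ'` of all of `L` such that every `α ∈ Θ` is the restriction
to `S` of some member of `Θ'`, i.e. `Θ ⊆ Θ'↾S`. -/
theorem stmt3 {L : Type*} [Lattice L] [BoundedOrder L] [Finite L]
    (S : Set L) (hS : IsSlsl S)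
    (Θ : Set (L → ℕ)) (hΘfin : Θ.Finite) (hΘ : IsUslRepOn S Θ) :
    ∃ Θ' : Set (L → ℕ), Θ'.Finite ∧ IsUslRep Θ' ∧
      ∀ α ∈ Θ, ∃ α' ∈ Θ', ∀ x ∈ S, α' x = α x := by
  classical
  obtain ⟨hb, ht, hm⟩ := hS
  obtain ⟨⟨α₀, hα₀, hz⟩, hbot, -, hord, hjoin⟩ := hΘ
  have hc : ∀ x : L, ∃ c, IsLeast {w ∈ S | x ≤ w} c := by
    intro x
    obtain ⟨m, hmin⟩ := (Set.toFinite {w ∈ S | x ≤ w}).exists_minimal ⟨⊤, ht, le_top⟩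
    refine ⟨m, hmin.1, fun w hw => ?_⟩
    have h1 : m ⊓ w ∈ {w ∈ S | x ≤ w} := ⟨hm _ hmin.1.1 _ hw.1, le_inf hmin.1.2 hw.2⟩
    exact le_trans (hmin.2 h1 inf_le_left) inf_le_right
  choose c hc using hc
  have cS : ∀ x, c x ∈ S := fun x => (hc x).1.1
  have cle : ∀ x, x ≤ c x := fun x => (hc x).1.2
  have cmin : ∀ x, ∀ w ∈ S, x ≤ w → c x ≤ w := fun x w h1 h2 => (hc x).2 ⟨h1, h2⟩
  have cid : ∀ x ∈ S, c x = x := fun x hx => le_antisymm (cmin x x hx le_rfl) (cle x)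
  have cmono : ∀ x y, x ≤ y → c x ≤ c y := fun x y h => cmin _ _ (cS y) (h.trans (cle y))
  have O : ∀ α ∈ Θ, ∀ β ∈ Θ, ∀ x y : L, x ≤ y → α (c y) = β (c y) → α (c x) = β (c x) :=
    fun α ha β hb x y h => hord α ha β hb _ (cS x) _ (cS y) (cmono x y h)
  have J : ∀ α ∈ Θ, ∀ β ∈ Θ, ∀ x y : L, α (c x) = β (c x) → α (c y) = β (c y) →
      α (c (x ⊔ y)) = β (c (x ⊔ y)) := by
    intro α ha β hb x y
    refine hjoin α ha β hb _ (cS x) _ (cS y) _ (cS _) ⟨⟨cS _, cmono _ _ le_sup_left,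
      cmono _ _ le_sup_right⟩, fun w hw => cmin _ _ hw.1 (sup_le ?_ ?_)⟩
    · exact (cle x).trans hw.2.1
    · exact (cle y).trans hw.2.2
  have z0 : ∀ x, α₀ (c x) = 0 := fun x => hz _ (cS x)
  have O0 : ∀ α ∈ Θ, ∀ x y : L, x ≤ y → α (c y) = 0 → α (c x) = 0 := by
    intro α ha x y h h1
    rw [← z0 x]; exact O α ha α₀ hα₀ x y h (by rw [h1, z0])
  have J0 : ∀ α ∈ Θ, ∀ x y : L, α (c x) = 0 → α (c y) = 0 → α (c (x ⊔ y)) = 0 := by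
    intro α ha x y h h1
    rw [← z0 (x ⊔ y)]; exact J α ha α₀ hα₀ x y (by rw [h, z0]) (by rw [h1, z0])
  obtain ⟨N, hN⟩ : ∃ N, ∀ α ∈ Θ, ∀ x, α x ≤ N := by
    obtain ⟨N, hN⟩ := ((hΘfin.prod (Set.finite_univ (α := L))).image
      (fun p => p.1 p.2)).bddAbove
    exact ⟨N, fun α ha x => hN ⟨(α, x), ⟨ha, trivial⟩, rfl⟩⟩
  obtain ⟨k, hk⟩ := Countable.exists_injective_nat L
  let g : L → L → ℕ := fun y x => if x ≤ y then 0 else N + 1 + k y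
  have g0 : ∀ y x, x ≤ y → g y x = 0 := fun y x h => if_pos h
  have g1 : ∀ y x, ¬ x ≤ y → g y x = N + 1 + k y := fun y x h => if_neg h
  have ag : ∀ α ∈ Θ, ∀ y x, α (c x) = g y x ↔ x ≤ y ∧ α (c x) = 0 := by
    intro α ha y x
    have := hN α ha (c x)
    by_cases h : x ≤ y
    · simp [g0 y x h, h]
    · simp only [g1 y x h, h, false_and, iff_false]; omega
  have gg : ∀ y y' x, g y x = g y' x ↔ y = y' ∨ (x ≤ y ∧ x ≤ y') := by
    intro y y' x
    have := @hk y y'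
    by_cases h : x ≤ y <;> by_cases h' : x ≤ y' <;> simp [g, h, h']
    · exact ⟨fun e => by omega, fun e => absurd (e ▸ h) h'⟩
    · rintro rfl; exact h h'
    · exact ⟨fun h => this h, fun h => by rw [h]⟩
  refine ⟨(fun α x => α (c x)) '' Θ ∪ Set.range g, (hΘfin.image _).union (Set.finite_range g),
    ⟨Or.inl ⟨α₀, hα₀, funext z0⟩, ?_, ?_, ?_, ?_⟩, ?_⟩
  · rintro _ (⟨α, ha, rfl⟩ | ⟨y, rfl⟩)
    · simpa [cid ⊥ hb] using hbot α ha
    · exact g0 _ _ bot_le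
  · intro x y h
    refine ⟨g y, Or.inr ⟨y, rfl⟩, g ⊤, Or.inr ⟨⊤, rfl⟩, ?_, ?_⟩
    · rw [g0 _ _ le_rfl, g0 _ _ le_top]
    · rw [g1 _ _ h, g0 _ _ le_top]; omega
  · rintro _ (⟨α, ha, rfl⟩ | ⟨u, rfl⟩) _ (⟨β, hb, rfl⟩ | ⟨v, rfl⟩) x y h e
    · exact O α ha β hb x y h e
    · have e := (ag α ha v y).1 e
      exact (ag α ha v x).2 ⟨h.trans e.1, O0 α ha x y h e.2⟩
    · have e := (ag β hb u y).1 e.symm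
      exact ((ag β hb u x).2 ⟨h.trans e.1, O0 β hb x y h e.2⟩).symm
    · rw [gg] at e ⊢
      exact e.imp_right fun e => ⟨h.trans e.1, h.trans e.2⟩
  · rintro _ (⟨α, ha, rfl⟩ | ⟨u, rfl⟩) _ (⟨β, hb, rfl⟩ | ⟨v, rfl⟩) x y _ rfl e f
    · exact J α ha β hb x y e f
    · have e := (ag α ha v x).1 e
      have f := (ag α ha v y).1 f
      exact (ag α ha v _).2 ⟨sup_le e.1 f.1, J0 α ha x y e.2 f.2⟩
    · have e := (ag β hb u x).1 e.symm
      have f := (ag β hb u y).1 f.symm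
      exact ((ag β hb u _).2 ⟨sup_le e.1 f.1, J0 β hb x y e.2 f.2⟩).symm
    · rw [gg] at e f ⊢
      rcases e with e | e
      · exact Or.inl e
      rcases f with f | f
      · exact Or.inl f
      exact Or.inr ⟨sup_le e.1 f.1, sup_le e.2 f.2⟩
  · intro α ha
    exact ⟨_, Or.inl ⟨α, ha, rfl⟩, fun x hx => by simp only [cid x hx]⟩
end

section
/- Fix a bounded lattice L, a sequence ⟨Θ_i⟩ of finite nonempty sets of functions from L to ℕ with Θ_i ⊆ Θ_{i+1}, a finite sublowersemilattice K₀ of L, and trees T₀, T₁ for ⟨Θ_i⟩ with T₁ ⊆_{K₀} T₀ (so k₁ = k(T₁) ≥ k₀ = k(T₀)). Let S be the restriction of T₁ to the empty string and the strings in ∏_{n=0}^{m} Θ_{k₀+n} for m ∈ ℕ (these lie in dom T₁ since Θ_{k₀+n} ⊆ Θ_{k₁+n}). Then S is a tree with k(S) = k₀, S ⊆_{K₀} T₀, and every path of S is a path of T₁, i.e., [S] ⊆ [T₁]. -/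
/-- The data of a tree for the sequence `⟨Θ i⟩` of sets of functions
`L → ℕ`: a parameter `k` and a map on finite strings (the map is only
relevant on the domain of the tree, the strings `σ` with
`σ n ∈ Θ (k + n)` for all `n < |σ|`). -/
structure ThetaTree (L : Type*) (Θ : ℕ → Set (L → ℕ)) where
  k : ℕ
  map : List (L → ℕ) → List (L → ℕ)

namespace ThetaTree

variable {L : Type*} {Θ : ℕ → Set (L → ℕ)}

/-- `σ` belongs to the domain of the tree `T`: its `n`-th entry lies in
`Θ (k(T) + n)`. (The empty string vacuously belongs to every domain.) -/
def InDom (T : ThetaTree L Θ) (σ : List (L → ℕ)) : Prop :=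
  ∀ (n : ℕ) (h : n < σ.length), σ.get ⟨n, h⟩ ∈ Θ (T.k + n)

/-- `T` is a tree for `⟨Θ i⟩`: on its domain, outputs are strings over the
`Θ n`'s of length at least that of the input, and `T` satisfies the order,
nonorder and uniformity properties. -/
def IsTree (T : ThetaTree L Θ) : Prop :=
  -- values are strings in `∏_{n=0}^{q} Θ n` with `q ≥ |σ| - 1`
  (∀ σ, T.InDom σ → σ.length ≤ (T.map σ).length ∧
    ∀ (n : ℕ) (h : n < (T.map σ).length), (T.map σ).get ⟨n, h⟩ ∈ Θ n) ∧
  -- (order)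
  (∀ σ τ, T.InDom σ → T.InDom τ → σ <+: τ → T.map σ <+: T.map τ) ∧
  -- (nonorder)
  (∀ σ τ, T.InDom σ → T.InDom τ → ¬σ <+: τ → ¬τ <+: σ →
    ¬T.map σ <+: T.map τ ∧ ¬T.map τ <+: T.map σ) ∧
  -- (uniformity): for each level `l` there are strings `ρ α`, all of the
  -- same length, with `T (σ ⌢ α) = T σ ⌢ ρ α` whenever `|σ| = l`
  (∀ l : ℕ, ∃ ρ : (L → ℕ) → List (L → ℕ),
    (∀ α ∈ Θ (T.k + l), ∀ β ∈ Θ (T.k + l), (ρ α).length = (ρ β).length) ∧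
    ∀ σ, T.InDom σ → σ.length = l → ∀ α ∈ Θ (T.k + l),
      T.map (σ ++ [α]) = T.map σ ++ ρ α)

/-- `S` is a subtree of `T`: `k(S) ≥ k(T)` and every node of `S` is a node
of `T` whose immediate successors in `S` extend the corresponding immediate
successors in `T`. -/
def Subtree (S T : ThetaTree L Θ) : Prop :=
  T.k ≤ S.k ∧
  ∀ σ, S.InDom σ → ∃ τ, T.InDom τ ∧ S.map σ = T.map τ ∧
    ∀ α ∈ Θ (S.k + σ.length), T.map (τ ++ [α]) <+: S.map (σ ++ [α])

/-- `S` is a subtree of `T` preserving the congruences of `Lhat`,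
`S ⊆_{Lhat} T`: whenever `x ∈ Lhat`, `S σ = T τ`, `α ≡_x β`,
`S (σ ⌢ α) = T (τ ⌢ μ)` and `S (σ ⌢ β) = T (τ ⌢ ν)` (with `μ, ν` of equal
length), then `μ ≡_x ν`, i.e. `μ j x = ν j x` for all `j`. -/
def SubtreeCong (S T : ThetaTree L Θ) (Lhat : Set L) : Prop :=
  Subtree S T ∧
  ∀ x ∈ Lhat, ∀ σ τ, S.InDom σ → T.InDom τ → S.map σ = T.map τ →
    ∀ α ∈ Θ (S.k + σ.length), ∀ β ∈ Θ (S.k + σ.length), α x = β x →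
      ∀ μ ν : List (L → ℕ), T.InDom (τ ++ μ) → T.InDom (τ ++ ν) →
        μ.length = ν.length →
        S.map (σ ++ [α]) = T.map (τ ++ μ) → S.map (σ ++ [β]) = T.map (τ ++ ν) →
        ∀ (j : ℕ) (hμ : j < μ.length) (hν : j < ν.length),
          μ.get ⟨j, hμ⟩ x = ν.get ⟨j, hν⟩ x

end ThetaTree

namespace ThetaTree

variable {L : Type*} {Θ : ℕ → Set (L → ℕ)}

/-- `f : ℕ → (L → ℕ)` is a path of the tree `T`, i.e. `f ∈ [T]`: for some
branch `G` (with `G m ∈ Θ (k(T) + m)` for all `m`), `f` is the union of the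
strings `T (G↾m)`, i.e. each `T (G↾m)` is an initial segment of `f`. -/
def IsPath (T : ThetaTree L Θ) (f : ℕ → (L → ℕ)) : Prop :=
  ∃ G : ℕ → (L → ℕ), (∀ m, G m ∈ Θ (T.k + m)) ∧
    ∀ m : ℕ, ∀ (n : ℕ) (h : n < (T.map (List.ofFn fun i : Fin m => G i)).length),
      (T.map (List.ofFn fun i : Fin m => G i)).get ⟨n, h⟩ = f n

end ThetaTree

/-- Part of Proposition 3.2 of Shore–Kjos-Hanssen: if `T₁ ⊆_{K₀} T₀`
(so `k₁ = k(T₁) ≥ k₀ = k(T₀)`) and `S` is the restriction of `T₁` to the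
strings over the sets `Θ (k₀ + n)` (which lie in `dom T₁` as
`Θ (k₀+n) ⊆ Θ (k₁+n)`), i.e. `S` has parameter `k₀` and the same map as
`T₁`, then `S` is a tree, `S ⊆_{K₀} T₀`, and `[S] ⊆ [T₁]`. -/
theorem stmt9 {L : Type*} [Lattice L] [BoundedOrder L]
    (Θ : ℕ → Set (L → ℕ))
    (hΘfin : ∀ i, (Θ i).Finite) (hΘne : ∀ i, (Θ i).Nonempty)
    (hΘmono : ∀ i, Θ i ⊆ Θ (i + 1))
    (K₀ : Set L) (hK₀fin : K₀.Finite) (hK₀ : IsSlsl K₀)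
    (T₀ T₁ : ThetaTree L Θ) (hT₀ : T₀.IsTree) (hT₁ : T₁.IsTree)
    (hsub : ThetaTree.SubtreeCong T₁ T₀ K₀) :
    (ThetaTree.mk T₀.k T₁.map : ThetaTree L Θ).IsTree ∧
    ThetaTree.SubtreeCong (ThetaTree.mk T₀.k T₁.map) T₀ K₀ ∧
    (∀ f : ℕ → (L → ℕ),
      (ThetaTree.mk T₀.k T₁.map : ThetaTree L Θ).IsPath f → T₁.IsPath f) := by
  obtain ⟨⟨hk, hs⟩, hc⟩ := hsub
  obtain ⟨h1, h2, h3, h4⟩ := hT₁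
  have hm : ∀ n, Θ (T₀.k + n) ⊆ Θ (T₁.k + n) := fun n =>
    monotone_nat_of_le_succ (f := Θ) hΘmono (by omega)
  have hd : ∀ σ, (ThetaTree.mk T₀.k T₁.map : ThetaTree L Θ).InDom σ → T₁.InDom σ :=
    fun σ h n hn => hm n (h n hn)
  refine ⟨⟨?_, ?_, ?_, ?_⟩, ⟨⟨le_refl _, ?_⟩, ?_⟩, ?_⟩
  · exact fun σ h => h1 σ (hd σ h)
  · exact fun σ τ h h' => h2 σ τ (hd σ h) (hd τ h')
  · exact fun σ τ h h' => h3 σ τ (hd σ h) (hd τ h')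
  · intro l
    obtain ⟨ρ, hr, hr'⟩ := h4 l
    exact ⟨ρ, fun α ha β hb => hr α (hm l ha) β (hm l hb),
      fun σ h hl α ha => hr' σ (hd σ h) hl α (hm l ha)⟩
  · intro σ h
    obtain ⟨τ, ht, he, hx⟩ := hs σ (hd σ h)
    exact ⟨τ, ht, he, fun α ha => hx α (hm _ ha)⟩
  · exact fun x hx σ τ h ht he α ha β hb => hc x hx σ τ (hd σ h) ht he α (hm _ ha) β (hm _ hb)
  · rintro f ⟨G, hG, hf⟩
    exact ⟨G, fun m => hm m (hG m), hf⟩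
end

section
/- Let B₀ and B₁ be finite lattices whose intersection A = B₀ ∩ B₁ is a sublattice of each, and assume the orders of B₀ and B₁ agree on A. Define a relation ≤_P on P = B₀ ∪ B₁ by: x ≤_P y iff x, y both lie in some B_i and x ≤_{B_i} y, or x ∈ B_i ∖ A and y ∈ B_{1−i} ∖ A and there exists a ∈ A with x <_{B_i} a and a <_{B_{1−i}} y. Then ≤_P is a partial order on P extending the orders of B₀ and B₁, and for all x, y ∈ B_i: the meet of x and y in B_i is the greatest lower bound of x and y with respect to ≤_P, and the join of x and y in B_i is the least upper bound of x and y with respect to ≤_P. -/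
/-- `z` is the greatest lower bound of `x` and `y` within `S` with respect to
the relation `r`. -/
def IsGlbOn {X : Type*} (S : Set X) (r : X → X → Prop) (x y z : X) : Prop :=
  z ∈ S ∧ r z x ∧ r z y ∧ ∀ w ∈ S, r w x → r w y → r w z

/-- `z` is the least upper bound of `x` and `y` within `S` with respect to
the relation `r`. -/
def IsLubOn {X : Type*} (S : Set X) (r : X → X → Prop) (x y z : X) : Prop :=
  z ∈ S ∧ r x z ∧ r y z ∧ ∀ w ∈ S, r x w → r y w → r z w

/-- `r` is a partial order on the subset `S`. -/
def IsPartialOrderOn {X : Type*} (S : Set X) (r : X → X → Prop) : Prop :=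
  (∀ x ∈ S, r x x) ∧
  (∀ x ∈ S, ∀ y ∈ S, r x y → r y x → x = y) ∧
  (∀ x ∈ S, ∀ y ∈ S, ∀ z ∈ S, r x y → r y z → r x z)

/-- The amalgamated order on `P = B₀ ∪ B₁` (with `A = B₀ ∩ B₁`):
`x ≤_P y` iff `x, y` both lie in some `B i` and `x ≤_{B i} y`, or
`x ∈ B i \ A`, `y ∈ B (1-i) \ A` and there is `a ∈ A` with `x <_{B i} a`
and `a <_{B (1-i)} y`. -/
def amalLe {X : Type*} (B₀ B₁ : Set X) (le₀ le₁ : X → X → Prop) (x y : X) : Prop :=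
  (x ∈ B₀ ∧ y ∈ B₀ ∧ le₀ x y) ∨
  (x ∈ B₁ ∧ y ∈ B₁ ∧ le₁ x y) ∨
  (x ∈ B₀ \ (B₀ ∩ B₁) ∧ y ∈ B₁ \ (B₀ ∩ B₁) ∧
    ∃ a ∈ B₀ ∩ B₁, (le₀ x a ∧ x ≠ a) ∧ (le₁ a y ∧ a ≠ y)) ∨
  (x ∈ B₁ \ (B₀ ∩ B₁) ∧ y ∈ B₀ \ (B₀ ∩ B₁) ∧
    ∃ a ∈ B₀ ∩ B₁, (le₁ x a ∧ x ≠ a) ∧ (le₀ a y ∧ a ≠ y))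

theorem amal_same {X : Type*} (B₀ B₁ : Set X) (le₀ le₁ : X → X → Prop)
    (hagree : ∀ x ∈ B₀ ∩ B₁, ∀ y ∈ B₀ ∩ B₁, (le₀ x y ↔ le₁ x y))
    (x : X) (hx : x ∈ B₀) (y : X) (hy : y ∈ B₀) :
    amalLe B₀ B₁ le₀ le₁ x y ↔ le₀ x y := by
  constructor
  · rintro (h | h | h | h)
    · exact h.2.2
    · exact (hagree x ⟨hx, h.1⟩ y ⟨hy, h.2.1⟩).2 h.2.2
    · exact absurd ⟨hy, h.2.1.1⟩ h.2.1.2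
    · exact absurd ⟨hx, h.1.1⟩ h.1.2
  · intro h
    exact Or.inl ⟨hx, hy, h⟩

theorem amal_diff {X : Type*} (B₀ B₁ : Set X) (le₀ le₁ : X → X → Prop)
    (hpo₀ : IsPartialOrderOn B₀ le₀) (hpo₁ : IsPartialOrderOn B₁ le₁)
    (hagree : ∀ x ∈ B₀ ∩ B₁, ∀ y ∈ B₀ ∩ B₁, (le₀ x y ↔ le₁ x y))
    (x : X) (hx : x ∈ B₀) (y : X) (hy : y ∈ B₁) :
    amalLe B₀ B₁ le₀ le₁ x y ↔ ∃ a, a ∈ B₀ ∧ a ∈ B₁ ∧ le₀ x a ∧ le₁ a y := by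
  constructor
  · rintro (h | h | h | h)
    · exact ⟨y, h.2.1, hy, h.2.2, hpo₁.1 y hy⟩
    · exact ⟨x, hx, h.1, hpo₀.1 x hx, h.2.2⟩
    · obtain ⟨-, -, a, ha, h1, h2⟩ := h
      exact ⟨a, ha.1, ha.2, h1.1, h2.1⟩
    · exact absurd ⟨hx, h.1.1⟩ h.1.2
  · rintro ⟨a, ha0, ha1, h1, h2⟩
    by_cases hx1 : x ∈ B₁
    · exact Or.inr (Or.inl ⟨hx1, hy, hpo₁.2.2 x hx1 a ha1 y hy
        ((hagree x ⟨hx, hx1⟩ a ⟨ha0, ha1⟩).1 h1) h2⟩)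
    by_cases hy0 : y ∈ B₀
    · exact Or.inl ⟨hx, hy0, hpo₀.2.2 x hx a ha0 y hy0 h1
        ((hagree a ⟨ha0, ha1⟩ y ⟨hy0, hy⟩).2 h2)⟩
    refine Or.inr (Or.inr (Or.inl ⟨⟨hx, fun h => hx1 h.2⟩, ⟨hy, fun h => hy0 h.1⟩, a,
      ⟨ha0, ha1⟩, ⟨h1, ?_⟩, ⟨h2, ?_⟩⟩))
    · rintro rfl
      exact hx1 ha1
    · rintro rfl
      exact hy0 ha0

theorem amal_swap {X : Type*} (B₀ B₁ : Set X) (le₀ le₁ : X → X → Prop) (x y : X) :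
    amalLe B₀ B₁ le₀ le₁ x y ↔ amalLe B₁ B₀ le₁ le₀ x y := by
  unfold amalLe
  rw [Set.inter_comm B₁ B₀]
  constructor <;> rintro (h | h | h | h)
  · exact Or.inr (Or.inl h)
  · exact Or.inl h
  · exact Or.inr (Or.inr (Or.inr h))
  · exact Or.inr (Or.inr (Or.inl h))
  · exact Or.inr (Or.inl h)
  · exact Or.inl h
  · exact Or.inr (Or.inr (Or.inr h))
  · exact Or.inr (Or.inr (Or.inl h))

theorem amal_glb {X : Type*} (B₀ B₁ : Set X) (le₀ le₁ R : X → X → Prop)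
    (hpo₀ : IsPartialOrderOn B₀ le₀)
    (hagree : ∀ x, x ∈ B₀ → x ∈ B₁ → ∀ y, y ∈ B₀ → y ∈ B₁ → (le₁ x y → le₀ x y))
    (hlat₁ : ∀ x ∈ B₁, ∀ y ∈ B₁, ∃ z, IsGlbOn B₁ le₁ x y z)
    (hA : ∀ x, x ∈ B₀ → x ∈ B₁ → ∀ y, y ∈ B₀ → y ∈ B₁ → ∀ z,
      IsGlbOn B₁ le₁ x y z → z ∈ B₀)
    (e0 : ∀ x ∈ B₀, ∀ y ∈ B₀, (R x y ↔ le₀ x y))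
    (e1 : ∀ x ∈ B₁, ∀ y ∈ B₀, (R x y ↔ ∃ a, a ∈ B₀ ∧ a ∈ B₁ ∧ le₁ x a ∧ le₀ a y))
    (S : Set X) (hS : ∀ x, x ∈ S ↔ x ∈ B₀ ∨ x ∈ B₁)
    (x : X) (hx : x ∈ B₀) (y : X) (hy : y ∈ B₀) (z : X) (hz : IsGlbOn B₀ le₀ x y z) :
    IsGlbOn S R x y z := by
  obtain ⟨hz0, hzx, hzy, hm⟩ := hz
  refine ⟨(hS z).2 (Or.inl hz0), (e0 z hz0 x hx).2 hzx, (e0 z hz0 y hy).2 hzy, ?_⟩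
  intro w hw hwx hwy
  rcases (hS w).1 hw with hw | hw
  · exact (e0 w hw z hz0).2 (hm w hw ((e0 w hw x hx).1 hwx) ((e0 w hw y hy).1 hwy))
  · obtain ⟨a, ha0, ha1, hwa, hax⟩ := (e1 w hw x hx).1 hwx
    obtain ⟨b, hb0, hb1, hwb, hby⟩ := (e1 w hw y hy).1 hwy
    obtain ⟨c, hc⟩ := hlat₁ a ha1 b hb1
    have hc0 := hA a ha0 ha1 b hb0 hb1 c hc
    obtain ⟨hc1, hca, hcb, hcm⟩ := hc
    exact (e1 w hw z hz0).2 ⟨c, hc0, hc1, hcm w hw hwa hwb, hm c hc0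
      (hpo₀.2.2 c hc0 a ha0 x hx (hagree c hc0 hc1 a ha0 ha1 hca) hax)
      (hpo₀.2.2 c hc0 b hb0 y hy (hagree c hc0 hc1 b hb0 hb1 hcb) hby)⟩

theorem po_flip {X : Type*} {B : Set X} {r : X → X → Prop} (h : IsPartialOrderOn B r) :
    IsPartialOrderOn B (fun a b => r b a) :=
  ⟨h.1, fun x hx y hy h1 h2 => h.2.1 x hx y hy h2 h1,
    fun x hx y hy z hz h1 h2 => h.2.2 z hz y hy x hx h2 h1⟩

/-- The amalgamated partial lattice from the proof of the amalgamation
property for finite lattices (Lemma 1.5 of Shore–Kjos-Hanssen): `B₀` and `B₁`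
are finite lattices (with orders `le₀`, `le₁` and all binary meets and joins)
whose intersection `A = B₀ ∩ B₁` is a common sublattice on which the two
orders agree. Then the amalgamated relation `≤_P` is a partial order on
`P = B₀ ∪ B₁` extending the two given orders, and the meets and joins of each
`B i` are greatest lower and least upper bounds with respect to `≤_P`. -/
theorem stmt11 {X : Type*} (B₀ B₁ : Set X) (le₀ le₁ : X → X → Prop)
    (hfin₀ : B₀.Finite) (hfin₁ : B₁.Finite)
    (hpo₀ : IsPartialOrderOn B₀ le₀) (hpo₁ : IsPartialOrderOn B₁ le₁)
    (hlat₀ : ∀ x ∈ B₀, ∀ y ∈ B₀,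
      (∃ z, IsGlbOn B₀ le₀ x y z) ∧ (∃ z, IsLubOn B₀ le₀ x y z))
    (hlat₁ : ∀ x ∈ B₁, ∀ y ∈ B₁,
      (∃ z, IsGlbOn B₁ le₁ x y z) ∧ (∃ z, IsLubOn B₁ le₁ x y z))
    (hagree : ∀ x ∈ B₀ ∩ B₁, ∀ y ∈ B₀ ∩ B₁, (le₀ x y ↔ le₁ x y))
    (hAmeet₀ : ∀ x ∈ B₀ ∩ B₁, ∀ y ∈ B₀ ∩ B₁, ∀ z,
      IsGlbOn B₀ le₀ x y z → z ∈ B₀ ∩ B₁)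
    (hAjoin₀ : ∀ x ∈ B₀ ∩ B₁, ∀ y ∈ B₀ ∩ B₁, ∀ z,
      IsLubOn B₀ le₀ x y z → z ∈ B₀ ∩ B₁)
    (hAmeet₁ : ∀ x ∈ B₀ ∩ B₁, ∀ y ∈ B₀ ∩ B₁, ∀ z,
      IsGlbOn B₁ le₁ x y z → z ∈ B₀ ∩ B₁)
    (hAjoin₁ : ∀ x ∈ B₀ ∩ B₁, ∀ y ∈ B₀ ∩ B₁, ∀ z,
      IsLubOn B₁ le₁ x y z → z ∈ B₀ ∩ B₁) :
    IsPartialOrderOn (B₀ ∪ B₁) (amalLe B₀ B₁ le₀ le₁) ∧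
    (∀ x ∈ B₀, ∀ y ∈ B₀, (le₀ x y ↔ amalLe B₀ B₁ le₀ le₁ x y)) ∧
    (∀ x ∈ B₁, ∀ y ∈ B₁, (le₁ x y ↔ amalLe B₀ B₁ le₀ le₁ x y)) ∧
    (∀ x ∈ B₀, ∀ y ∈ B₀, ∀ z, IsGlbOn B₀ le₀ x y z →
      IsGlbOn (B₀ ∪ B₁) (amalLe B₀ B₁ le₀ le₁) x y z) ∧
    (∀ x ∈ B₀, ∀ y ∈ B₀, ∀ z, IsLubOn B₀ le₀ x y z →
      IsLubOn (B₀ ∪ B₁) (amalLe B₀ B₁ le₀ le₁) x y z) ∧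
    (∀ x ∈ B₁, ∀ y ∈ B₁, ∀ z, IsGlbOn B₁ le₁ x y z →
      IsGlbOn (B₀ ∪ B₁) (amalLe B₀ B₁ le₀ le₁) x y z) ∧
    (∀ x ∈ B₁, ∀ y ∈ B₁, ∀ z, IsLubOn B₁ le₁ x y z →
      IsLubOn (B₀ ∪ B₁) (amalLe B₀ B₁ le₀ le₁) x y z) := by
  have hagree' : ∀ x ∈ B₁ ∩ B₀, ∀ y ∈ B₁ ∩ B₀, (le₁ x y ↔ le₀ x y) :=
    fun x hx y hy => (hagree x hx.symm y hy.symm).symm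
  have e00 := amal_same B₀ B₁ le₀ le₁ hagree
  have e01 := amal_diff B₀ B₁ le₀ le₁ hpo₀ hpo₁ hagree
  have e11 : ∀ x ∈ B₁, ∀ y ∈ B₁, (amalLe B₀ B₁ le₀ le₁ x y ↔ le₁ x y) := fun x hx y hy =>
    (amal_swap B₀ B₁ le₀ le₁ x y).trans (amal_same B₁ B₀ le₁ le₀ hagree' x hx y hy)
  have e10 : ∀ x ∈ B₁, ∀ y ∈ B₀, (amalLe B₀ B₁ le₀ le₁ x y ↔
      ∃ a, a ∈ B₁ ∧ a ∈ B₀ ∧ le₁ x a ∧ le₀ a y) := fun x hx y hy =>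
    (amal_swap B₀ B₁ le₀ le₁ x y).trans (amal_diff B₁ B₀ le₁ le₀ hpo₁ hpo₀ hagree' x hx y hy)
  generalize amalLe B₀ B₁ le₀ le₁ = R at *
  have r0 := hpo₀.1
  have r1 := hpo₁.1
  have a0 := hpo₀.2.1
  have a1 := hpo₁.2.1
  have t0 := hpo₀.2.2
  have t1 := hpo₁.2.2
  have anti : ∀ x ∈ B₀, ∀ y ∈ B₁, R x y → R y x → x = y := by
    intro x hx y hy h1 h2
    obtain ⟨a, ha0, ha1, hxa, hay⟩ := (e01 x hx y hy).1 h1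
    obtain ⟨b, hb1, hb0, hyb, hbx⟩ := (e10 y hy x hx).1 h2
    have hab1 := t1 a ha1 y hy b hb1 hay hyb
    have hba0 := t0 b hb0 x hx a ha0 hbx hxa
    have hab0 := (hagree a ⟨ha0, ha1⟩ b ⟨hb0, hb1⟩).2 hab1
    have hab := a0 a ha0 b hb0 hab0 hba0
    subst hab
    exact (a0 x hx a ha0 hxa hbx).trans (a1 a ha1 y hy hay hyb)
  refine ⟨⟨?_, ?_, ?_⟩, fun x hx y hy => (e00 x hx y hy).symm,
    fun x hx y hy => (e11 x hx y hy).symm, ?_, ?_, ?_, ?_⟩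
  · rintro x (hx | hx)
    · exact (e00 x hx x hx).2 (r0 x hx)
    · exact (e11 x hx x hx).2 (r1 x hx)
  · rintro x (hx | hx) y (hy | hy) h1 h2
    · exact a0 x hx y hy ((e00 x hx y hy).1 h1) ((e00 y hy x hx).1 h2)
    · exact anti x hx y hy h1 h2
    · exact (anti y hy x hx h2 h1).symm
    · exact a1 x hx y hy ((e11 x hx y hy).1 h1) ((e11 y hy x hx).1 h2)
  · rintro x (hx | hx) y (hy | hy) z (hz | hz) h1 h2
    · exact (e00 x hx z hz).2
        (t0 x hx y hy z hz ((e00 x hx y hy).1 h1) ((e00 y hy z hz).1 h2))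
    · rw [e00 x hx y hy] at h1
      obtain ⟨a, ha0, ha1, h3, h4⟩ := (e01 y hy z hz).1 h2
      exact (e01 x hx z hz).2 ⟨a, ha0, ha1, t0 x hx y hy a ha0 h1 h3, h4⟩
    · obtain ⟨a, ha0, ha1, h3, h4⟩ := (e01 x hx y hy).1 h1
      obtain ⟨b, hb1, hb0, h5, h6⟩ := (e10 y hy z hz).1 h2
      have hab := (hagree a ⟨ha0, ha1⟩ b ⟨hb0, hb1⟩).2 (t1 a ha1 y hy b hb1 h4 h5)
      exact (e00 x hx z hz).2 (t0 x hx b hb0 z hz (t0 x hx a ha0 b hb0 h3 hab) h6)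
    · rw [e11 y hy z hz] at h2
      obtain ⟨a, ha0, ha1, h3, h4⟩ := (e01 x hx y hy).1 h1
      exact (e01 x hx z hz).2 ⟨a, ha0, ha1, h3, t1 a ha1 y hy z hz h4 h2⟩
    · rw [e00 y hy z hz] at h2
      obtain ⟨a, ha1, ha0, h3, h4⟩ := (e10 x hx y hy).1 h1
      exact (e10 x hx z hz).2 ⟨a, ha1, ha0, h3, t0 a ha0 y hy z hz h4 h2⟩
    · obtain ⟨a, ha1, ha0, h3, h4⟩ := (e10 x hx y hy).1 h1
      obtain ⟨b, hb0, hb1, h5, h6⟩ := (e01 y hy z hz).1 h2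
      have hab := (hagree a ⟨ha0, ha1⟩ b ⟨hb0, hb1⟩).1 (t0 a ha0 y hy b hb0 h4 h5)
      exact (e11 x hx z hz).2 (t1 x hx b hb1 z hz (t1 x hx a ha1 b hb1 h3 hab) h6)
    · rw [e11 x hx y hy] at h1
      obtain ⟨a, ha1, ha0, h3, h4⟩ := (e10 y hy z hz).1 h2
      exact (e10 x hx z hz).2 ⟨a, ha1, ha0, t1 x hx y hy a ha1 h1 h3, h4⟩
    · exact (e11 x hx z hz).2
        (t1 x hx y hy z hz ((e11 x hx y hy).1 h1) ((e11 y hy z hz).1 h2))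
  · exact amal_glb B₀ B₁ le₀ le₁ R hpo₀
      (fun x h h' y k k' => (hagree x ⟨h, h'⟩ y ⟨k, k'⟩).2)
      (fun x hx y hy => (hlat₁ x hx y hy).1)
      (fun x h h' y k k' z hz => (hAmeet₁ x ⟨h, h'⟩ y ⟨k, k'⟩ z hz).1) e00
      (fun x hx y hy => (e10 x hx y hy).trans (by grind)) _ (fun x => Iff.rfl)
  · exact amal_glb B₀ B₁ (fun a b => le₀ b a) (fun a b => le₁ b a) (fun a b => R b a)
      (po_flip hpo₀)
      (fun x h h' y k k' => (hagree y ⟨k, k'⟩ x ⟨h, h'⟩).2)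
      (fun x hx y hy => (hlat₁ x hx y hy).2)
      (fun x h h' y k k' z hz => (hAjoin₁ x ⟨h, h'⟩ y ⟨k, k'⟩ z hz).1)
      (fun x hx y hy => e00 y hy x hx)
      (fun x hx y hy => (e01 y hy x hx).trans (by grind)) _ (fun x => Iff.rfl)
  · exact amal_glb B₁ B₀ le₁ le₀ R hpo₁
      (fun x h h' y k k' => (hagree x ⟨h', h⟩ y ⟨k', k⟩).1)
      (fun x hx y hy => (hlat₀ x hx y hy).1)
      (fun x h h' y k k' z hz => (hAmeet₀ x ⟨h', h⟩ y ⟨k', k⟩ z hz).2) e11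
      (fun x hx y hy => (e01 x hx y hy).trans (by grind)) _ (fun x => Or.comm)
  · exact amal_glb B₁ B₀ (fun a b => le₁ b a) (fun a b => le₀ b a) (fun a b => R b a)
      (po_flip hpo₁)
      (fun x h h' y k k' => (hagree y ⟨k', k⟩ x ⟨h', h⟩).1)
      (fun x hx y hy => (hlat₀ x hx y hy).2)
      (fun x h h' y k k' z hz => (hAjoin₀ x ⟨h', h⟩ y ⟨k', k⟩ z hz).2)
      (fun x hx y hy => e11 y hy x hx)
      (fun x hx y hy => (e10 y hy x hx).trans (by grind)) _ (fun x => Or.comm)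
end

section
/- Fix a countable bounded lattice L, a sublattice K of L containing 0 and 1, a nested sequence ⟨L_i⟩ of finite sublowersemilattices of L with L_0 = {0,1} and ⋃_i L_i = L, and a nested sequence ⟨Θ_i⟩ of finite nonempty sets of functions from L to ℕ. Define the forcing poset P whose conditions are pairs ⟨T, K̂⟩ with T a tree for ⟨Θ_i⟩ and K̂ a finite sublowersemilattice of L contained in K ∩ L_{k(T)}, where ⟨T₁, K₁⟩ extends ⟨T₀, K₀⟩ iff T₁ ⊆_{K₀} T₀ and K₁ ⊇ K₀. Then for every x ∈ K and every k ∈ ℕ, the sets {⟨T, K̂⟩ : x ∈ K̂} and {⟨T, K̂⟩ : k(T) ≥ k} are dense in P: every condition has an extension lying in each of these sets. -/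
/-- A condition of the forcing notion `P_{⟨L_i, Θ_i⟩, K}`: a pair
`⟨T, Khat⟩` with `T` a tree for `⟨Θ i⟩` and `Khat` a finite
sublowersemilattice of `L` contained in `K ∩ L_{k(T)}`. -/
def IsCond {L : Type*} [Lattice L] [BoundedOrder L] {Θ : ℕ → Set (L → ℕ)}
    (K : Set L) (Ls : ℕ → Set L) (T : ThetaTree L Θ) (Khat : Set L) : Prop :=
  T.IsTree ∧ Khat.Finite ∧ IsSlsl Khat ∧ Khat ⊆ K ∩ Ls T.k

/-- `⟨T₁, K₁⟩` extends `⟨T₀, K₀⟩`: `T₁ ⊆_{K₀} T₀` and `K₁ ⊇ K₀`. -/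
def CondExtends {L : Type*} [Lattice L] [BoundedOrder L] {Θ : ℕ → Set (L → ℕ)}
    (T₁ : ThetaTree L Θ) (K₁ : Set L) (T₀ : ThetaTree L Θ) (K₀ : Set L) : Prop :=
  ThetaTree.SubtreeCong T₁ T₀ K₀ ∧ K₀ ⊆ K₁

namespace ThetaTree

variable {L : Type*} {Θ : ℕ → Set (L → ℕ)}

theorem inDom_append (T : ThetaTree L Θ) (σ τ : List (L → ℕ)) :
    T.InDom (σ ++ τ) ↔ T.InDom σ ∧
      ∀ (n : ℕ) (h : n < τ.length), τ[n] ∈ Θ (T.k + (σ.length + n)) := by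
  constructor
  · intro h
    refine ⟨fun n hn => ?_, fun n hn => ?_⟩
    · have := h n (by simp; omega)
      simpa [List.getElem_append_left hn] using this
    · have := h (σ.length + n) (by simp; omega)
      simpa using this
  · rintro ⟨h1, h2⟩ n hn
    by_cases hc : n < σ.length
    · have := h1 n hc
      simpa [List.getElem_append_left hc] using this
    · have hn' : n < σ.length + τ.length := by simpa using hn
      have := h2 (n - σ.length) (by omega)
      have e : σ.length + (n - σ.length) = n := by omega
      rw [e] at this
      simpa [List.getElem_append_right (Nat.le_of_not_lt hc)] using this

theorem inDom_snoc (T : ThetaTree L Θ) (σ : List (L → ℕ)) (α : L → ℕ) :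
    T.InDom (σ ++ [α]) ↔ T.InDom σ ∧ α ∈ Θ (T.k + σ.length) := by
  rw [inDom_append]
  constructor
  · rintro ⟨h1, h2⟩
    exact ⟨h1, by simpa using h2 0 (by simp)⟩
  · rintro ⟨h1, h2⟩
    refine ⟨h1, fun n hn => ?_⟩
    have : n = 0 := by simpa using hn
    subst this
    simpa using h2

theorem comparable {T : ThetaTree L Θ} (hT : T.IsTree) {a b : List (L → ℕ)}
    (ha : T.InDom a) (hb : T.InDom b) (h : T.map a = T.map b) : a <+: b ∨ b <+: a := by
  by_contra hc
  push Not at hc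
  exact (hT.2.2.1 a b ha hb hc.1 hc.2).1 (h ▸ List.prefix_rfl)

theorem level_subsingleton {T : ThetaTree L Θ} (hT : T.IsTree) {a d : List (L → ℕ)}
    (hb : T.InDom (a ++ d)) (h : T.map a = T.map (a ++ d))
    (j : ℕ) (hj : j < d.length) :
    ∀ α ∈ Θ (T.k + (a.length + j)), ∀ β ∈ Θ (T.k + (a.length + j)), α = β := by
  obtain ⟨d1, γ, d2, rfl, rfl⟩ : ∃ d1 γ d2, d = d1 ++ γ :: d2 ∧ d1.length = j :=
    ⟨d.take j, d[j], d.drop (j+1), by simp, by simp; omega⟩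
  have e : a ++ (d1 ++ γ :: d2) = ((a ++ d1) ++ [γ]) ++ d2 := by simp
  rw [e] at hb h
  have h2 := ((inDom_append T _ _).1 hb).1
  obtain ⟨h1, hγ⟩ := (inDom_snoc T _ _).1 h2
  have h0 := ((inDom_append T _ _).1 h1).1
  have p0 := (hT.2.1 _ _ h0 h1 (List.prefix_append _ _)).length_le
  have p2 := (hT.2.1 _ _ h2 hb (List.prefix_append _ _)).length_le
  rw [← h] at p2
  obtain ⟨ρ, hρ, hu⟩ := hT.2.2.2 (a ++ d1).length
  have hl := congrArg List.length (hu _ h1 rfl γ hγ)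
  rw [List.length_append] at hl
  have hz : (ρ γ).length = 0 := by omega
  have hnil : ∀ α ∈ Θ (T.k + (a ++ d1).length), ρ α = [] := fun α hα => by
    rw [← List.length_eq_zero_iff, hρ α hα γ hγ, hz]
  intro α hα β hβ
  rw [← List.length_append] at hα hβ
  have e : T.map (a ++ d1 ++ [α]) = T.map (a ++ d1 ++ [β]) := by
    rw [hu _ h1 rfl α hα, hu _ h1 rfl β hβ, hnil α hα, hnil β hβ]
  rcases comparable hT ((inDom_snoc T _ _).2 ⟨h1, hα⟩) ((inDom_snoc T _ _).2 ⟨h1, hβ⟩) e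
    with h | h
  · simpa using h
  · simpa [eq_comm] using h

theorem exists_string (hΘne : ∀ i, (Θ i).Nonempty) (T : ThetaTree L Θ) (m : ℕ) :
    ∃ π, T.InDom π ∧ π.length = m := by
  induction m with
  | zero => exact ⟨[], fun n h => by simp at h, rfl⟩
  | succ m ih =>
    obtain ⟨π, h, rfl⟩ := ih
    obtain ⟨α, hα⟩ := hΘne (T.k + π.length)
    exact ⟨π ++ [α], (inDom_snoc T _ _).2 ⟨h, hα⟩, by simp⟩

/-- the tree above the node `π` -/
def above (T : ThetaTree L Θ) (π : List (L → ℕ)) : ThetaTree L Θ :=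
  ⟨T.k + π.length, fun σ => T.map (π ++ σ)⟩

theorem above_inDom {T : ThetaTree L Θ} {π : List (L → ℕ)} (hπ : T.InDom π)
    (σ : List (L → ℕ)) : (T.above π).InDom σ ↔ T.InDom (π ++ σ) := by
  rw [inDom_append, and_iff_right hπ]
  simp [InDom, above, Nat.add_assoc]

theorem above_isTree {T : ThetaTree L Θ} (hT : T.IsTree) {π : List (L → ℕ)}
    (hπ : T.InDom π) : (T.above π).IsTree := by
  refine ⟨fun σ hσ => ?_, fun σ τ hσ hτ h => ?_, fun σ τ hσ hτ h h' => ?_, fun l => ?_⟩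
  · obtain ⟨h1, h2⟩ := hT.1 _ ((above_inDom hπ σ).1 hσ)
    refine ⟨?_, h2⟩
    simp only [List.length_append] at h1
    simp only [above]
    omega
  · exact hT.2.1 _ _ ((above_inDom hπ σ).1 hσ) ((above_inDom hπ τ).1 hτ)
      ((List.prefix_append_right_inj π).2 h)
  · exact hT.2.2.1 _ _ ((above_inDom hπ σ).1 hσ) ((above_inDom hπ τ).1 hτ)
      (fun q => h ((List.prefix_append_right_inj π).1 q))
      (fun q => h' ((List.prefix_append_right_inj π).1 q))
  · obtain ⟨ρ, hρ, hu⟩ := hT.2.2.2 (π.length + l)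
    rw [← Nat.add_assoc] at hρ hu
    refine ⟨ρ, hρ, fun σ hσ hl α hα => ?_⟩
    have := hu (π ++ σ) ((above_inDom hπ σ).1 hσ) (by simp [hl]) α hα
    simpa [above] using this

theorem above_subtree {T : ThetaTree L Θ} {π : List (L → ℕ)}
    (hπ : T.InDom π) : (T.above π).Subtree T :=
  ⟨Nat.le_add_right _ _, fun σ hσ => ⟨π ++ σ, (above_inDom hπ σ).1 hσ, rfl, fun α _ => by
    simp [above]⟩⟩

theorem above_cong {T : ThetaTree L Θ} (hT : T.IsTree) {π : List (L → ℕ)}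
    (hπ : T.InDom π) (M : Set L) : (T.above π).SubtreeCong T M := by
  refine ⟨above_subtree hπ, ?_⟩
  intro x _ σ τ hσ hτ hστ α hα β hβ hαβ μ ν hμ hν hlen eμ eν j jμ jν
  by_cases hab : α = β
  · subst hab
    have hc : μ = ν := by
      rcases comparable hT hμ hν (eμ.symm.trans eν) with h | h
      · exact ((List.prefix_append_right_inj τ).1 h).eq_of_length hlen
      · exact (((List.prefix_append_right_inj τ).1 h).eq_of_length hlen.symm).symm
    subst hc
    rfl
  have ha := (above_inDom hπ σ).1 hσ
  have hS : (T.above π).k + σ.length = T.k + (π ++ σ).length := by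
    simp [above, Nat.add_assoc]
  rw [hS] at hα hβ
  simp only [above, ← List.append_assoc] at hστ eμ eν
  generalize π ++ σ = a at *
  have haα := (inDom_snoc T _ _).2 ⟨ha, hα⟩
  have haβ := (inDom_snoc T _ _).2 ⟨ha, hβ⟩
  have hpre : τ <+: a := by
    rcases comparable hT ha hτ hστ with ⟨d, rfl⟩ | h
    · by_cases hd : d.length = 0
      · rw [List.length_eq_zero_iff.1 hd]; simp
      · exact absurd (level_subsingleton hT hτ hστ 0 (by omega) α hα β hβ) hab
    · exact h
  obtain ⟨d, rfl⟩ := hpre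
  have cμ := comparable hT hμ haα eμ.symm
  have cν := comparable hT hν haβ eν.symm
  rw [List.append_assoc, List.prefix_append_right_inj, List.prefix_append_right_inj] at cμ cν
  by_cases hjd : j < d.length
  · have key : ∀ (κ : List (L → ℕ)) (γ : L → ℕ) (h : j < κ.length),
        (κ <+: d ++ [γ] ∨ d ++ [γ] <+: κ) → κ[j] = d[j] := by
      intro κ γ h hc
      rcases hc with hc | hc
      · rw [hc.getElem h]
        exact List.getElem_append_left hjd
      · rw [← hc.getElem (by simp; omega)]
        exact List.getElem_append_left hjd
    simp only [List.get_eq_getElem]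
    rw [key μ α jμ cμ, key ν β jν cν]
  · have key : ∀ (κ : List (L → ℕ)) (γ : L → ℕ), j < κ.length →
        (κ <+: d ++ [γ] ∨ d ++ [γ] <+: κ) → ∃ κ', κ = d ++ [γ] ++ κ' := by
      intro κ γ h hc
      rcases hc with hc | hc
      · exact ⟨[], by rw [List.append_nil]; exact hc.eq_of_length_le (by simp; omega)⟩
      · obtain ⟨t, rfl⟩ := hc
        exact ⟨t, rfl⟩
    obtain ⟨μ', rfl⟩ := key μ α jμ cμ
    obtain ⟨ν', rfl⟩ := key ν β jν cν
    simp only [List.get_eq_getElem]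
    by_cases hj : j = d.length
    · subst hj
      simpa using hαβ
    · have mμ := hμ (τ.length + j) (by simp at jμ ⊢; omega)
      have mν := hν (τ.length + j) (by simp at jν ⊢; omega)
      simp only [List.get_eq_getElem,
        List.getElem_append_right (Nat.le_add_right _ _), Nat.add_sub_cancel_left] at mμ mν
      rw [← List.append_assoc, ← List.append_assoc] at hμ eμ
      simp only [List.length_append, List.length_singleton] at jμ
      have := level_subsingleton hT hμ eμ (j - d.length - 1) (by omega)
      have e : (τ ++ d ++ [α]).length + (j - d.length - 1) = τ.length + j := by
        simp; omega
      rw [e] at this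
      rw [this _ mμ _ mν]

end ThetaTree

/-- Lemma 2.11 of Shore–Kjos-Hanssen (basic density): for each `x ∈ K` and
`k ∈ ℕ` the sets `{⟨T, Khat⟩ : x ∈ Khat}` and `{⟨T, Khat⟩ : k(T) ≥ k}` are
dense in the forcing notion: every condition has an extension in each. -/
theorem stmt14 {L : Type*} [Lattice L] [BoundedOrder L] [Countable L]
    (K : Set L)
    (hK : ⊥ ∈ K ∧ ⊤ ∈ K ∧ (∀ x ∈ K, ∀ y ∈ K, x ⊔ y ∈ K) ∧
      (∀ x ∈ K, ∀ y ∈ K, x ⊓ y ∈ K))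
    (Ls : ℕ → Set L)
    (hLsfin : ∀ i, (Ls i).Finite) (hLsslsl : ∀ i, IsSlsl (Ls i))
    (hLsmono : ∀ i, Ls i ⊆ Ls (i + 1)) (hLs0 : Ls 0 = {⊥, ⊤})
    (hLsunion : (⋃ i, Ls i) = Set.univ)
    (Θ : ℕ → Set (L → ℕ))
    (hΘfin : ∀ i, (Θ i).Finite) (hΘne : ∀ i, (Θ i).Nonempty)
    (hΘmono : ∀ i, Θ i ⊆ Θ (i + 1))
    (x : L) (hx : x ∈ K) (k : ℕ)
    (T : ThetaTree L Θ) (Khat : Set L) (hcond : IsCond K Ls T Khat) :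
    (∃ (T' : ThetaTree L Θ) (Khat' : Set L),
      IsCond K Ls T' Khat' ∧ CondExtends T' Khat' T Khat ∧ x ∈ Khat') ∧
    (∃ (T' : ThetaTree L Θ) (Khat' : Set L),
      IsCond K Ls T' Khat' ∧ CondExtends T' Khat' T Khat ∧ k ≤ T'.k) := by
  obtain ⟨hT, hKf, hKs, hKsub⟩ := hcond
  have hmono : Monotone Ls := monotone_nat_of_le_succ hLsmono
  obtain ⟨i, hi⟩ : ∃ i, x ∈ Ls i := by
    have : x ∈ ⋃ i, Ls i := hLsunion ▸ Set.mem_univ x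
    simpa using this
  obtain ⟨π, hπ, hl⟩ := ThetaTree.exists_string hΘne T (i + k)
  have hk : (T.above π).k = T.k + (i + k) := by simp [ThetaTree.above, hl]
  have hc : IsCond K Ls (T.above π) (K ∩ Ls (T.above π).k) := by
    obtain ⟨h1, h2, h3⟩ := hLsslsl (T.above π).k
    exact ⟨ThetaTree.above_isTree hT hπ, (hLsfin _).subset Set.inter_subset_right,
      ⟨⟨hK.1, h1⟩, ⟨hK.2.1, h2⟩, fun a ha b hb =>
        ⟨hK.2.2.2 a ha.1 b hb.1, h3 a ha.2 b hb.2⟩⟩, subset_rfl⟩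
  have he : CondExtends (T.above π) (K ∩ Ls (T.above π).k) T Khat :=
    ⟨ThetaTree.above_cong hT hπ Khat, fun a ha =>
      ⟨(hKsub ha).1, hmono (by omega) (hKsub ha).2⟩⟩
  exact ⟨⟨_, _, hc, he, hx, hmono (by omega) hi⟩, ⟨_, _, hc, he, by omega⟩⟩
end
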